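/- arXiv:1210.4137 — 2 statements merged into one kernel-verified Lean document; each statement's English description precedes it below -/
import Mathlib

section
/- There is a finitely generated group H with elements g₁, g₂ of infinite order such that g₁ and g₂ are forward equivalent (s(g₁^∞, g₂^∞) = 0) but not backward equivalent (s(g₁^{-∞}, g₂^{-∞}) > 0). Concretely, in H = ⟨a,s,t,x | t^{-1}at = a^2, s^{-1}as = a^2, x^{-1}sx = s^2⟩ one may take g₁ = t and g₂ = at. -/
/-- The word length of `g` with respect to the generating set `X` (letters from `X ∪ X⁻¹`). -/
noncomputable def wordLength {G : Type*} [Group G] (X : Set G) (g : G) : ℕ :=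
  sInf {n : ℕ | ∃ l : List G, l.length = n ∧ (∀ x ∈ l, x ∈ X ∨ x⁻¹ ∈ X) ∧ l.prod = g}

/-- The word metric on `G` associated to the generating set `X`. -/
noncomputable def wordDist {G : Type*} [Group G] (X : Set G) (g h : G) : ℕ :=
  wordLength X (g⁻¹ * h)

/-- `inCone X g h α c` : the forward orbit `g^∞ = {gⁿ : n ∈ ℕ}` is contained in the
`(α,c)`-cone around the forward orbit `h^∞`, i.e. each `gⁿ` lies in some ball
`B(hᵐ, α·d(1,hᵐ) + c)`. -/
def inCone {G : Type*} [Group G] (X : Set G) (g h : G) (α : ℝ) (c : ℕ) : Prop :=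
  ∀ n : ℕ, ∃ m : ℕ,
    (wordDist X (h ^ m) (g ^ n) : ℝ) ≤ α * (wordDist X 1 (h ^ m) : ℝ) + (c : ℝ)

/-- `sDist X g h = inf {α ∈ ℝ : ∃ c ∈ ℕ, g^∞ ∈ α·h^∞ + c and h^∞ ∈ α·g^∞ + c}`,
the quantity `s(g^∞, h^∞)` of Krön–Lehnert–Seifter–Teufl. -/
noncomputable def sDist {G : Type*} [Group G] (X : Set G) (g h : G) : ℝ :=
  sInf {α : ℝ | ∃ c : ℕ, inCone X g h α c ∧ inCone X h g α c}

section WordLength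
variable {G : Type*} [Group G] {X : Set G}

theorem wl_exists (hX : Subgroup.closure X = ⊤) (g : G) :
    ∃ l : List G, l.length = wordLength X g ∧ (∀ x ∈ l, x ∈ X ∨ x⁻¹ ∈ X) ∧ l.prod = g := by
  have : {n : ℕ | ∃ l : List G, l.length = n ∧ (∀ x ∈ l, x ∈ X ∨ x⁻¹ ∈ X) ∧ l.prod = g}.Nonempty := by
    have hg : g ∈ (Subgroup.closure X).toSubmonoid := by rw [hX]; trivial
    rw [Subgroup.closure_toSubmonoid] at hg
    obtain ⟨l, h1, h2⟩ := Submonoid.exists_list_of_mem_closure hg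
    exact ⟨l.length, l, rfl, h1, h2⟩
  exact Nat.sInf_mem this

theorem wl_le {g : G} (l : List G) (h : ∀ x ∈ l, x ∈ X ∨ x⁻¹ ∈ X) (hp : l.prod = g) :
    wordLength X g ≤ l.length := Nat.sInf_le ⟨l, rfl, h, hp⟩

theorem wl_one : wordLength X (1 : G) = 0 := by
  have := wl_le (X := X) (g := 1) [] (by simp) (by simp)
  simpa using this

theorem wl_mem {g : G} (h : g ∈ X) : wordLength X g ≤ 1 :=
  wl_le [g] (by simp [h]) (by simp)

theorem wl_mul (hX : Subgroup.closure X = ⊤) (g h : G) :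
    wordLength X (g * h) ≤ wordLength X g + wordLength X h := by
  obtain ⟨l, h1, h2, h3⟩ := wl_exists hX g
  obtain ⟨l', h1', h2', h3'⟩ := wl_exists hX h
  rw [← h1, ← h1', ← List.length_append]
  apply wl_le
  · intro x hx
    rcases List.mem_append.1 hx with hx | hx
    · exact h2 x hx
    · exact h2' x hx
  · simp [h3, h3']

theorem wl_inv_le (hX : Subgroup.closure X = ⊤) (g : G) :
    wordLength X g⁻¹ ≤ wordLength X g := by
  obtain ⟨l, h1, h2, h3⟩ := wl_exists hX g
  rw [← h1]
  have := wl_le (X := X) (g := g⁻¹) (l.map (·⁻¹)).reverse ?_ ?_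
  · simpa using this
  · intro x hx
    simp only [List.mem_reverse, List.mem_map] at hx
    obtain ⟨y, hy, rfl⟩ := hx
    have := h2 y hy
    simp only [inv_inv]
    tauto
  · rw [← h3, List.prod_inv_reverse]

theorem wl_inv (hX : Subgroup.closure X = ⊤) (g : G) :
    wordLength X g⁻¹ = wordLength X g :=
  le_antisymm (wl_inv_le hX g) (by simpa using wl_inv_le hX g⁻¹)

theorem wl_pow (hX : Subgroup.closure X = ⊤) (g : G) (n : ℕ) :
    wordLength X (g ^ n) ≤ n * wordLength X g := by
  induction n with
  | zero => simp [wl_one]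
  | succ n ih =>
    rw [pow_succ]
    have := wl_mul hX (g ^ n) g
    nlinarith

theorem le_wl (hX : Subgroup.closure X = ⊤) (f : G → ℕ) (h1 : f 1 = 0)
    (hf : ∀ x g, (x ∈ X ∨ x⁻¹ ∈ X) → f (x * g) ≤ f g + 1) (g : G) : f g ≤ wordLength X g := by
  obtain ⟨l, e, h2, rfl⟩ := wl_exists hX g
  rw [← e]
  clear e
  induction l with
  | nil => simp [h1]
  | cons x l ih =>
    have := ih (fun y hy => h2 y (List.mem_cons_of_mem _ hy))
    have := hf x l.prod (h2 x (by simp))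
    simp only [List.prod_cons, List.length_cons]
    omega

end WordLength

theorem final {G : Type*} [Group G] {X : Set G} (hX : Subgroup.closure X = ⊤)
    (a s q t : G) (ha : a ∈ X) (hs : s ∈ X) (hq : q ∈ X) (ht : t ∈ X)
    (hat : a * t = t * a ^ 2) (has : a * s = s * a ^ 2) (hsq : s * q = q * s ^ 2)
    (η : G →* Multiplicative ℤ) (ηt : η t = Multiplicative.ofAdd 1) (ηa : η a = 1)
    (ηX : ∀ x ∈ X, x = t ∨ η x = 1)
    (hτ : ∀ m n : ℕ, m + n ≤ wordLength X ((a * t) ^ (m + 1) * (t⁻¹) ^ (n + 1))) :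
    ¬ IsOfFinOrder t ∧ ¬ IsOfFinOrder (a * t) ∧
      sDist X t (a * t) = 0 ∧ 0 < sDist X t⁻¹ (a * t)⁻¹ := by
  have hη : ∀ g, (Multiplicative.toAdd (η g)).natAbs ≤ wordLength X g := by
    apply le_wl hX
    · simp
    · intro x g hx
      have : (Multiplicative.toAdd (η x)).natAbs ≤ 1 := by
        rcases hx with hx | hx
        · rcases ηX x hx with rfl | h
          · simp [ηt]
          · simp [h]
        · rcases ηX _ hx with h | h
          · rw [inv_eq_iff_eq_inv] at h
            simp [h, ηt]
          · rw [map_inv, inv_eq_one] at h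
            simp [h]
      simp only [map_mul, toAdd_mul]
      omega
  have lt : ∀ n : ℕ, n ≤ wordLength X (t ^ n) := fun n => by
    simpa [ηt] using hη (t ^ n)
  have lat : ∀ n : ℕ, n ≤ wordLength X ((a * t) ^ n) := fun n => by
    simpa [ηt, ηa] using hη ((a * t) ^ n)
  have ut : ∀ n : ℕ, wordLength X (t ^ n) ≤ n := fun n => by
    have := wl_pow hX t n
    have := wl_mem ht
    nlinarith
  have uat : ∀ n : ℕ, wordLength X ((a * t) ^ n) ≤ 2 * n := fun n => by
    have := wl_pow hX (a * t) n
    have := wl_mul hX a t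
    have := wl_mem ht
    have := wl_mem ha
    nlinarith
  have notfin : ∀ g : G, (∀ n : ℕ, n ≤ wordLength X (g ^ n)) → ¬ IsOfFinOrder g := by
    intro g hg h
    obtain ⟨n, hn, h⟩ := isOfFinOrder_iff_pow_eq_one.1 h
    have := hg n
    rw [h, wl_one] at this
    omega
  -- upper bound on powers of s
  have us : ∀ n : ℕ, wordLength X (s ^ n) ≤ 3 * Nat.log 2 n + 1 := by
    intro n
    induction n using Nat.strong_induction_on with
    | _ n ih =>
    by_cases h2 : n < 2
    · have := wl_pow hX s n
      have := wl_mem hs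
      nlinarith
    · have h := ih (n / 2) (by omega)
      rw [Nat.log_of_one_lt_of_le (by norm_num) (by omega)]
      have e : s ^ n = q⁻¹ * s ^ (n / 2) * q * s ^ (n % 2) := by
        have h1 : ∀ k : ℕ, s ^ k * q = q * s ^ (2 * k) := by
          intro k
          induction k with
          | zero => simp
          | succ k ih => rw [pow_succ, mul_assoc, hsq, ← mul_assoc, ih, mul_assoc, ← pow_add]; congr 2
        rw [mul_assoc q⁻¹, h1, inv_mul_cancel_left, ← pow_add]
        congr 1; omega
      have a1 := wl_mul hX (q⁻¹ * s ^ (n / 2) * q) (s ^ (n % 2))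
      have a2 := wl_mul hX (q⁻¹ * s ^ (n / 2)) q
      have a3 := wl_mul hX q⁻¹ (s ^ (n / 2))
      have a4 := wl_inv hX q
      have a5 := wl_mem hq
      have a6 := wl_pow hX s (n % 2)
      have a7 := wl_mem hs
      have a8 : n % 2 ≤ 1 := by omega
      have a9 : n % 2 * wordLength X s ≤ 1 * 1 := Nat.mul_le_mul a8 a7
      rw [e]
      omega
  have ua : ∀ n : ℕ, wordLength X (a ^ (2 ^ n)) ≤ 6 * Nat.log 2 n + 3 := by
    intro n
    have e : a ^ (2 ^ n) = (s ^ n)⁻¹ * a * s ^ n := by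
      rw [mul_assoc, eq_inv_mul_iff_mul_eq]
      induction n with
      | zero => simp
      | succ n ih =>
        have h1 : ∀ k : ℕ, a ^ k * s = s * a ^ (2 * k) := by
          intro k
          induction k with
          | zero => simp
          | succ k ih => rw [pow_succ, mul_assoc, has, ← mul_assoc, ih, mul_assoc, ← pow_add]; congr 2
        rw [pow_succ s, ← mul_assoc, ← ih, pow_succ', mul_assoc, ← h1, mul_assoc]
    have a1 := wl_mul hX ((s ^ n)⁻¹ * a) (s ^ n)
    have a2 := wl_mul hX (s ^ n)⁻¹ a
    have a3 := wl_inv hX (s ^ n)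
    have a4 := us n
    have a5 := wl_mem ha
    rw [e]
    omega
  have key : ∀ n : ℕ, wordLength X ((t ^ n)⁻¹ * (a * t) ^ n) ≤ 6 * Nat.log 2 (n + 1) + 5 := by
    intro n
    have e : (a * t) ^ n * a ^ 2 = t ^ n * a ^ (2 ^ (n + 1)) := by
      have h1 : ∀ k : ℕ, a ^ k * t = t * a ^ (2 * k) := by
        intro k
        induction k with
        | zero => simp
        | succ k ih => rw [pow_succ, mul_assoc, hat, ← mul_assoc, ih, mul_assoc, ← pow_add]; congr 2
      induction n with
      | zero => simp
      | succ n ih =>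
        calc (a * t) ^ (n + 1) * a ^ 2 = (a * t) ^ n * a * (t * a ^ 2) := by
              rw [pow_succ]; simp only [mul_assoc]
          _ = (a * t) ^ n * a ^ 2 * t := by rw [← hat, pow_two]; simp only [mul_assoc]
          _ = _ := by rw [ih, mul_assoc, h1, ← mul_assoc, ← pow_succ]; congr 2; ring
    have e' : (t ^ n)⁻¹ * (a * t) ^ n = a ^ (2 ^ (n + 1)) * (a ^ 2)⁻¹ := by
      rw [eq_mul_inv_iff_mul_eq, mul_assoc, e, inv_mul_cancel_left]
    have a1 := wl_mul hX (a ^ (2 ^ (n + 1))) (a ^ 2)⁻¹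
    have a2 := wl_inv hX (a ^ 2)
    have a3 := wl_pow hX a 2
    have a4 := wl_mem ha
    have a5 := ua (n + 1)
    rw [e']
    omega
  have key' : ∀ n : ℕ, wordLength X (((a * t) ^ n)⁻¹ * t ^ n) ≤ 6 * Nat.log 2 (n + 1) + 5 := by
    intro n
    have := key n
    rw [← wl_inv hX] at this
    simpa using this
  have hlog : ∀ ε : ℝ, 0 < ε → ∃ c : ℕ, ∀ n : ℕ,
      ((6 * Nat.log 2 (n + 1) + 5 : ℕ) : ℝ) ≤ ε * n + c := by
    intro ε hε
    have hl2 : 0 < Real.log 2 := Real.log_pos (by norm_num)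
    set δ := ε * Real.log 2 / 6 with hδ
    have hδ0 : 0 < δ := by positivity
    obtain ⟨c, hc⟩ := exists_nat_ge (5 + 6 / Real.log 2 * (δ - Real.log δ))
    refine ⟨c, fun n => ?_⟩
    have h1 : (Nat.log 2 (n + 1) : ℝ) * Real.log 2 ≤ Real.log (n + 1) := by
      rw [← Real.log_pow]
      apply Real.log_le_log (by positivity)
      have := Nat.pow_log_le_self 2 (x := n + 1) (by omega)
      exact_mod_cast this
    have h2 : Real.log (n + 1) ≤ δ * (n + 1) - Real.log δ := by
      have h3 : Real.log (δ * (n + 1)) = Real.log δ + Real.log (n + 1) :=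
        Real.log_mul hδ0.ne' (by positivity)
      have := Real.log_le_sub_one_of_pos (x := δ * (n + 1)) (by positivity)
      linarith
    have h4 : (Nat.log 2 (n + 1) : ℝ) ≤ (δ * (n + 1) - Real.log δ) / Real.log 2 := by
      rw [le_div_iff₀ hl2]; linarith
    have h5 : 6 * ((δ * (n + 1) - Real.log δ) / Real.log 2)
        = ε * n + 6 / Real.log 2 * (δ - Real.log δ) := by
      rw [hδ]; field_simp; ring
    push_cast
    linarith
  refine ⟨notfin t lt, notfin _ lat, ?_, ?_⟩
  · -- forward
    have low : ∀ α ∈ {α : ℝ | ∃ c : ℕ, inCone X t (a * t) α c ∧ inCone X (a * t) t α c}, 0 ≤ α := by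
      rintro α ⟨c, h, -⟩
      by_contra! hα
      obtain ⟨n, hn⟩ := exists_nat_gt ((c : ℝ) / (-α) + c)
      obtain ⟨m, hm⟩ := h n
      simp only [wordDist, inv_one, one_mul] at hm
      have b1 : (wordLength X (t ^ n) : ℝ) ≤ wordLength X ((a * t) ^ m)
          + wordLength X (((a * t) ^ m)⁻¹ * t ^ n) := by
        have := wl_mul hX ((a * t) ^ m) (((a * t) ^ m)⁻¹ * t ^ n)
        rw [mul_inv_cancel_left] at this
        exact_mod_cast this
      have b2 : (n : ℝ) ≤ wordLength X (t ^ n) := by exact_mod_cast lt n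
      have b3 : (0 : ℝ) ≤ wordLength X (((a * t) ^ m)⁻¹ * t ^ n) := by positivity
      have b4 : (0 : ℝ) ≤ wordLength X ((a * t) ^ m) := by positivity
      have b5 : (wordLength X ((a * t) ^ m) : ℝ) ≤ c / (-α) := by
        rw [le_div_iff₀ (by linarith)]; linarith
      nlinarith
    have mem : ∀ α : ℝ, 0 < α →
        α ∈ {α : ℝ | ∃ c : ℕ, inCone X t (a * t) α c ∧ inCone X (a * t) t α c} := by
      intro α hα
      obtain ⟨c, hc⟩ := hlog α hα
      refine ⟨c, fun n => ⟨n, ?_⟩, fun n => ⟨n, ?_⟩⟩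
      · simp only [wordDist, inv_one, one_mul]
        have b1 : (wordLength X (((a * t) ^ n)⁻¹ * t ^ n) : ℝ) ≤
          ((6 * Nat.log 2 (n + 1) + 5 : ℕ) : ℝ) := by exact_mod_cast key' n
        have b2 : (n : ℝ) ≤ wordLength X ((a * t) ^ n) := by exact_mod_cast lat n
        have := hc n
        nlinarith
      · simp only [wordDist, inv_one, one_mul]
        have b1 : (wordLength X ((t ^ n)⁻¹ * (a * t) ^ n) : ℝ) ≤
          ((6 * Nat.log 2 (n + 1) + 5 : ℕ) : ℝ) := by exact_mod_cast key n
        have b2 : (n : ℝ) ≤ wordLength X (t ^ n) := by exact_mod_cast lt n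
        have := hc n
        nlinarith
    apply le_antisymm
    · apply le_of_forall_pos_le_add
      intro ε hε
      rw [zero_add]
      exact csInf_le ⟨0, low⟩ (mem ε hε)
    · exact le_csInf ⟨1, mem 1 one_pos⟩ low
  · -- backward
    apply lt_of_lt_of_le (b := (1 / 2 : ℝ)) (by norm_num)
    apply le_csInf
    · refine ⟨2, 0, fun n => ⟨2 * n, ?_⟩, fun n => ⟨2 * n, ?_⟩⟩
      all_goals
        simp only [wordDist, inv_one, one_mul, inv_pow, inv_inv]
        rw [wl_inv hX]
      · have a1 := wl_mul hX ((a * t) ^ (2 * n)) (t ^ n)⁻¹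
        rw [wl_inv hX] at a1
        have a2 := ut n
        have a3 := lat (2 * n)
        have : wordLength X ((a * t) ^ (2 * n) * (t ^ n)⁻¹) ≤
          2 * wordLength X ((a * t) ^ (2 * n)) + 0 := by omega
        exact_mod_cast this
      · have a1 := wl_mul hX (t ^ (2 * n)) ((a * t) ^ n)⁻¹
        rw [wl_inv hX] at a1
        have a2 := uat n
        have a3 := lt (2 * n)
        have : wordLength X (t ^ (2 * n) * ((a * t) ^ n)⁻¹) ≤
          2 * wordLength X (t ^ (2 * n)) + 0 := by omega
        exact_mod_cast this
    · rintro α ⟨c, h, -⟩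
      by_contra! hα
      obtain ⟨m, hm⟩ := h (c + 3)
      simp only [wordDist, inv_one, one_mul] at hm
      have b1 : (m : ℝ) + (c + 1) ≤
          wordLength X (((a * t)⁻¹ ^ m)⁻¹ * t⁻¹ ^ (c + 3)) := by
        rw [inv_pow (a * t), inv_inv]
        cases m with
        | zero =>
          have := lt (c + 3)
          rw [← wl_inv hX, ← inv_pow] at this
          have h2 : 0 + (c + 1) ≤ wordLength X ((a * t) ^ 0 * t⁻¹ ^ (c + 3)) := by
            rw [pow_zero, one_mul]; omega
          exact_mod_cast h2
        | succ m =>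
          have := hτ m (c + 2)
          have h2 : m + 1 + (c + 1) ≤ wordLength X ((a * t) ^ (m + 1) * t⁻¹ ^ (c + 3)) := by
            have e : c + 2 + 1 = c + 3 := rfl
            rw [e] at this
            omega
          exact_mod_cast h2
      have b2 : (wordLength X ((a * t)⁻¹ ^ m) : ℝ) ≤ 2 * m := by
        rw [inv_pow, wl_inv hX]
        exact_mod_cast uat m
      have b3 : (0 : ℝ) ≤ wordLength X ((a * t)⁻¹ ^ m) := by positivity
      nlinarith

section HNN
open HNNExtension HNNExtension.NormalWord

variable {K : Type*} [Group K] {A B : Subgroup K} (φ : A ≃* B)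

open Classical in
theorem unitsSMul_length_le (d : TransversalPair K A B) (u : ℤˣ) (w : NormalWord d) :
    (unitsSMul φ u w).toList.length ≤ w.toList.length + 1 := by
  unfold unitsSMul
  split_ifs with h
  · induction w using consRecOn with
    | ofGroup g => simp [Cancels, ofGroup] at h
    | cons g u' w h1 h2 ih =>
      simp [unitsSMulWithCancel]
      omega
  · simp

theorem hnn_length {X : Set (HNNExtension K A B φ)} (hX : Subgroup.closure X = ⊤)
    (hX' : ∀ x ∈ X, x = t ∨ ∃ k, x = of k) (w : ReducedWord K A B) :
    w.toList.length ≤ wordLength X (w.prod φ) := by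
  obtain ⟨d⟩ := TransversalPair.nonempty K A B
  obtain ⟨w', e1, e2, -⟩ := ReducedWord.exists_normalWord_prod_eq φ d w
  have h := le_wl hX (fun g => (g • (empty : NormalWord d)).toList.length) (by simp [empty]) ?_
    (w.prod φ)
  · rw [← e1] at h
    simp only [prod_smul_empty] at h
    have := congrArg List.length e2
    simp only [List.length_map] at this
    rw [← e1]
    omega
  · intro x g hx
    simp only [mul_smul]
    have key : ∀ u : ℤˣ, ((t ^ (u : ℤ) : HNNExtension K A B φ) • g • (empty : NormalWord d)).toList.length
        ≤ (g • (empty : NormalWord d)).toList.length + 1 := by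
      intro u
      rw [t_pow_smul_eq_unitsSMul]
      apply unitsSMul_length_le
    have key2 : ∀ k : K, ((of k : HNNExtension K A B φ) • g • (empty : NormalWord d)).toList.length
        ≤ (g • (empty : NormalWord d)).toList.length + 1 := by
      intro k
      rw [of_smul_eq_smul]
      simp
    rcases hx with hx | hx
    · rcases hX' x hx with rfl | ⟨k, rfl⟩
      · simpa using key 1
      · exact key2 k
    · rcases hX' _ hx with h | ⟨k, h⟩
      · rw [inv_eq_iff_eq_inv] at h
        subst h
        simpa using key (-1)
      · rw [inv_eq_iff_eq_inv, ← map_inv] at h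
        subst h
        exact key2 _

end HNN

theorem core {K : Type} [Group K] (Y : Set K) (hYf : Y.Finite) (hY : Subgroup.closure Y = ⊤)
    (a s q : K) (ha : a ∈ Y) (hs : s ∈ Y) (hq : q ∈ Y)
    (has : a * s = s * a ^ 2) (hsq : s * q = q * s ^ 2)
    (hinj : Function.Injective (zpowersHom K a)) :
    ∃ (G : Type) (_ : Group G) (X : Set G) (g₁ g₂ : G),
      X.Finite ∧ Subgroup.closure X = ⊤ ∧
      ¬ IsOfFinOrder g₁ ∧ ¬ IsOfFinOrder g₂ ∧
      sDist X g₁ g₂ = 0 ∧ 0 < sDist X g₁⁻¹ g₂⁻¹ := by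
  have hinj2 : Function.Injective (zpowersHom K (a ^ 2)) := by
    intro x y h
    have h' : zpowersHom K a (Multiplicative.ofAdd (2 * x.toAdd)) =
        zpowersHom K a (Multiplicative.ofAdd (2 * y.toAdd)) := by
      simpa only [zpowersHom_apply, toAdd_ofAdd, zpow_mul, zpow_one, zpow_ofNat, pow_one] using h
    have := congrArg Multiplicative.toAdd (hinj h')
    simp only [toAdd_ofAdd] at this
    apply Multiplicative.toAdd.injective
    omega
  let A := (zpowersHom K (a ^ 2)).range
  let B := (zpowersHom K a).range
  let φ : A ≃* B := (MonoidHom.ofInjective hinj2).symm.trans (MonoidHom.ofInjective hinj)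
  have haA : a ∉ A := by
    rintro ⟨n, hn⟩
    have h' : zpowersHom K a (Multiplicative.ofAdd (2 * n.toAdd)) =
        zpowersHom K a (Multiplicative.ofAdd 1) := by
      simpa only [zpowersHom_apply, toAdd_ofAdd, zpow_mul, zpow_one, zpow_ofNat, pow_one] using hn
    have := congrArg Multiplicative.toAdd (hinj h')
    simp only [toAdd_ofAdd] at this
    omega
  let G := HNNExtension K A B φ
  let X : Set G := insert HNNExtension.t (HNNExtension.of '' Y)
  have hXf : X.Finite := (hYf.image _).insert _
  have hX : Subgroup.closure X = ⊤ := by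
    rw [eq_top_iff]
    intro x _
    induction x using HNNExtension.induction_on with
    | of g =>
      have : g ∈ Subgroup.closure Y := by rw [hY]; trivial
      have h2 : HNNExtension.of g ∈ (Subgroup.closure Y).map (HNNExtension.of : K →* G) := ⟨g, this, rfl⟩
      rw [MonoidHom.map_closure] at h2
      exact Subgroup.closure_mono (Set.subset_insert _ _) h2
    | t => exact Subgroup.subset_closure (Set.mem_insert _ _)
    | mul x y hx hy => exact mul_mem (hx trivial) (hy trivial)
    | inv x hx => exact inv_mem (hx trivial)
  have hφ : ((φ ⟨a ^ 2, ⟨Multiplicative.ofAdd 1, by simp⟩⟩ : B) : K) = a := by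
    have : (⟨a ^ 2, ⟨Multiplicative.ofAdd 1, by simp⟩⟩ : A) =
        MonoidHom.ofInjective hinj2 (Multiplicative.ofAdd 1) := by
      apply Subtype.ext
      rw [MonoidHom.ofInjective_apply]
      simp
    rw [this]
    simp only [φ, MulEquiv.trans_apply, MulEquiv.symm_apply_apply]
    rw [MonoidHom.ofInjective_apply]
    simp
  have hat : (HNNExtension.of a * HNNExtension.t : G) = HNNExtension.t * (HNNExtension.of a) ^ 2 := by
    have := HNNExtension.t_mul_of (φ := φ) (⟨a ^ 2, ⟨Multiplicative.ofAdd 1, by simp⟩⟩ : A)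
    rw [hφ] at this
    rw [← this, map_pow]
  refine ⟨G, inferInstance, X, HNNExtension.t, HNNExtension.of a * HNNExtension.t, hXf, hX, ?_⟩
  refine final hX (HNNExtension.of a) (HNNExtension.of s) (HNNExtension.of q) HNNExtension.t
    (Or.inr ⟨a, ha, rfl⟩) (Or.inr ⟨s, hs, rfl⟩) (Or.inr ⟨q, hq, rfl⟩) (Or.inl rfl) hat
    (by simp only [← map_mul, ← map_pow, has]) (by simp only [← map_mul, ← map_pow, hsq])
    (HNNExtension.lift 1 (Multiplicative.ofAdd 1) (by simp))
    (HNNExtension.lift_t _ _ _) (HNNExtension.lift_of _ _ _ _) ?_ ?_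
  · rintro x (rfl | ⟨y, -, rfl⟩)
    · exact Or.inl rfl
    · exact Or.inr (HNNExtension.lift_of _ _ _ _)
  · intro m n
    let w : HNNExtension.NormalWord.ReducedWord K A B :=
      { head := a
        toList := List.replicate m (1, a) ++ List.replicate n (-1, 1)
        chain := by
          rw [List.isChain_append]
          refine ⟨?_, ?_, ?_⟩
          · exact List.isChain_replicate_of_rel _ (fun _ => rfl)
          · exact List.isChain_replicate_of_rel _ (fun _ => rfl)
          · intro x hx y hy hxA
            have : x = (1, a) := List.eq_of_mem_replicate (List.mem_of_mem_getLast? hx)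
            subst this
            exact absurd hxA haA }
    have h := hnn_length φ hX (by
      rintro x (rfl | ⟨y, -, rfl⟩)
      · exact Or.inl rfl
      · exact Or.inr ⟨y, rfl⟩) w
    have e : w.prod φ = (HNNExtension.of a * HNNExtension.t) ^ (m + 1) *
        (HNNExtension.t⁻¹) ^ (n + 1) := by
      have h1 : ∀ (x y : G) (m : ℕ), x * (y * x) ^ m = (x * y) ^ m * x := by
        intro x y m
        induction m with
        | zero => simp
        | succ m ih => rw [pow_succ, ← mul_assoc, ih, pow_succ]; simp only [mul_assoc]
      simp only [w, HNNExtension.NormalWord.ReducedWord.prod, List.map_append, List.map_replicate,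
        List.prod_append, List.prod_replicate]
      rw [pow_succ, pow_succ' (HNNExtension.t⁻¹ : HNNExtension K A B φ)]
      simp only [Units.val_one, zpow_one, Units.val_neg, zpow_neg, map_one, mul_one]
      rw [← mul_assoc, h1]
      simp only [mul_assoc, mul_inv_cancel_left]
    rw [e] at h
    simpa [w] using h

/-- Signed square. -/
noncomputable def sgnSq : Equiv.Perm ℝ where
  toFun y := y * |y|
  invFun y := if 0 ≤ y then √y else -√(-y)
  left_inv y := by
    rcases le_total 0 y with h | h
    · have : 0 ≤ y * |y| := by positivity
      simp only [this, if_true]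
      rw [abs_of_nonneg h, Real.sqrt_mul_self h]
    · rcases h.eq_or_lt with rfl | h
      · simp
      have : ¬ 0 ≤ y * |y| := by
        rw [abs_of_neg h]; nlinarith
      simp only [this, if_false]
      rw [abs_of_neg h, show -(y * -y) = (-y) * (-y) by ring, Real.sqrt_mul_self (by linarith)]
      ring
  right_inv y := by
    by_cases h : 0 ≤ y
    · simp only [h, if_true]
      rw [abs_of_nonneg (Real.sqrt_nonneg _), Real.mul_self_sqrt h]
    · simp only [h, if_false]
      rw [abs_neg, abs_of_nonneg (Real.sqrt_nonneg _), neg_mul, Real.mul_self_sqrt (by linarith)]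
      ring

/-- There is a finitely generated group with elements `g₁, g₂` of infinite order which are
forward equivalent (`s(g₁^∞, g₂^∞) = 0`) but not backward equivalent
(`s(g₁^{-∞}, g₂^{-∞}) > 0`). -/
theorem exists_forward_not_backward_equivalent :
    ∃ (G : Type) (_ : Group G) (X : Set G) (g₁ g₂ : G),
      X.Finite ∧ Subgroup.closure X = ⊤ ∧
      ¬ IsOfFinOrder g₁ ∧ ¬ IsOfFinOrder g₂ ∧
      sDist X g₁ g₂ = 0 ∧ 0 < sDist X g₁⁻¹ g₂⁻¹ := by
  let a : Equiv.Perm ℝ := Equiv.addRight 1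
  let s : Equiv.Perm ℝ := Equiv.mulRight₀ (1 / 2 : ℝ) (by norm_num)
  let q : Equiv.Perm ℝ := sgnSq⁻¹
  let S : Set (Equiv.Perm ℝ) := {a, s, q}
  let K := Subgroup.closure S
  have haK : a ∈ S := by simp [S]
  have hsK : s ∈ S := by simp [S]
  have hqK : q ∈ S := by simp [S]
  refine core (K := K) (Subtype.val ⁻¹' S) ?_ Subgroup.closure_closure_coe_preimage
    ⟨a, Subgroup.subset_closure haK⟩ ⟨s, Subgroup.subset_closure hsK⟩
    ⟨q, Subgroup.subset_closure hqK⟩ haK hsK hqK ?_ ?_ ?_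
  · exact Set.Finite.preimage Subtype.val_injective.injOn (by simp [S])
  · apply Subtype.ext
    change a * s = s * a ^ 2
    ext y
    simp [a, s, pow_two]
    ring
  · apply Subtype.ext
    change s * q = q * s ^ 2
    have : q⁻¹ * s = s ^ 2 * q⁻¹ := by
      ext y
      simp [q, s, pow_two, sgnSq, abs_mul]
      ring
    rw [← inv_mul_eq_iff_eq_mul, ← mul_assoc, this, inv_mul_cancel_right]
  · have hp : ∀ (n : ℤ) (y : ℝ), (a ^ n) y = y + n := by
      intro n y
      simp [a]
    intro x y h
    have h2 := congrArg (fun k : K => (k : Equiv.Perm ℝ) 0) h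
    simp only [zpowersHom_apply, Subgroup.coe_zpow, hp] at h2
    apply Multiplicative.toAdd.injective
    simpa using h2
end

section
/- Let p ≥ 2 and G' = ⟨a₀,a₁,... | a_j^{-1}a_{j-1}a_j = a_{j-1}^p⟩ with generating set {a_i : i ≥ 0}. Let k ≥ i ≥ 0. Then every geodesic word in G' that contains the letter a_k^{±1} and represents an element of the cyclic subgroup ⟨a_{k-i}⟩ has length at least 2^{i+1} − 1. -/
/-- The relators `a_{j+1}⁻¹ a_j a_{j+1} (a_j^p)⁻¹` of the group
`G' = ⟨a₀, a₁, … ∣ a_{j+1}⁻¹ a_j a_{j+1} = a_j^p⟩`. -/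
def gpRels (p : ℕ) : Set (FreeGroup ℕ) :=
  {r | ∃ j : ℕ, r = (FreeGroup.of (j + 1))⁻¹ * FreeGroup.of j * FreeGroup.of (j + 1) *
    (FreeGroup.of j ^ p)⁻¹}

namespace GP

open Monoid

/-- Reduced alternating products in an amalgam are not in the base. -/
theorem amalg_not_mem_base {Γ : Type} [Group Γ] (S : Bool → Subgroup Γ) (C : Subgroup Γ)
    (hC : ∀ b, C ≤ S b)
    (Φ : Γ →* PushoutI (fun b => Subgroup.inclusion (hC b)))
    (hΦ : ∀ b (x : S b), Φ x = PushoutI.of b x)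
    (F : List (Bool × Γ)) (hne : F ≠ []) (hmem : ∀ x ∈ F, x.2 ∈ S x.1) (hnC : ∀ x ∈ F, x.2 ∉ C)
    (hch : F.IsChain (fun x y => x.1 ≠ y.1)) : (F.map Prod.snd).prod ∉ C := by
  intro hprod
  have hlift : ∃ W : List (Σ b, S b), W.map (fun x => (x.1, (x.2 : Γ))) = F := by
    clear hne hnC hch hprod
    induction F with
    | nil => exact ⟨[], rfl⟩
    | cons a F ih =>
      obtain ⟨W, hW⟩ := ih (fun x hx => hmem x (List.mem_cons_of_mem _ hx))
      exact ⟨⟨a.1, ⟨a.2, hmem a List.mem_cons_self⟩⟩ :: W, by simp [hW]⟩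
  obtain ⟨W, rfl⟩ := hlift
  have hred : ∀ g ∈ W, g.2 ∉ (Subgroup.inclusion (hC g.1)).range := by
    rintro g hg ⟨c, hc⟩
    refine hnC _ (List.mem_map_of_mem hg) ?_
    have : ((Subgroup.inclusion (hC g.1) c : S g.1) : Γ) = g.2 := by rw [hc]
    simp only [Subgroup.coe_inclusion] at this
    simp [← this]
  let w : CoprodI.Word (fun b => S b) :=
    { toList := W
      ne_one := fun l hl h1 => hred l hl (by rw [h1]; exact one_mem _)
      chain_ne := by
        have := (List.isChain_map _).1 hch
        exact this }
  have hw : PushoutI.Reduced (fun b => Subgroup.inclusion (hC b)) w := hred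
  have hval : PushoutI.ofCoprodI (φ := fun b => Subgroup.inclusion (hC b)) w.prod
      = Φ ((W.map (fun x => (x.1, (x.2 : Γ)))).map Prod.snd).prod := by
    simp only [CoprodI.Word.prod, map_list_prod, List.map_map, w]
    congr 1
    apply List.map_congr_left
    intro x _
    simp [hΦ]
  have := hw.eq_empty_of_mem_range (fun b => Subgroup.inclusion_injective _) (by
    rw [hval]
    refine ⟨⟨_, hprod⟩, ?_⟩
    rw [← PushoutI.of_apply_eq_base _ true, ← hΦ]
    simp)
  apply hne
  have h2 : w.toList = [] := by rw [this]; rfl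
  have h3 : W = [] := h2
  simp [h3]

theorem amalg_not_mem {Γ : Type} [Group Γ] (S : Bool → Subgroup Γ) (C : Subgroup Γ)
    (hC : ∀ b, C ≤ S b)
    (Φ : Γ →* PushoutI (fun b => Subgroup.inclusion (hC b)))
    (hΦ : ∀ b (x : S b), Φ x = PushoutI.of b x)
    (F : List (Bool × Γ)) (hlen : 2 ≤ F.length) (hmem : ∀ x ∈ F, x.2 ∈ S x.1)
    (hnC : ∀ x ∈ F, x.2 ∉ C)
    (hch : F.IsChain (fun x y => x.1 ≠ y.1)) : (F.map Prod.snd).prod ∉ S true := by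
  have key : ∀ (g : Γ) (F : List (Bool × Γ)), (∀ x ∈ (false, g) :: F, x.2 ∈ S x.1) →
    (∀ x ∈ (false, g) :: F, x.2 ∉ C) → (((false, g) :: F).IsChain (fun x y => x.1 ≠ y.1)) →
    (((false, g) :: F).map Prod.snd).prod ∉ S true := by
    intro g F hmem hnC hch h
    by_cases hc : (((false, g) :: F).map Prod.snd).prod ∈ C
    · exact amalg_not_mem_base S C hC Φ hΦ _ (by simp) hmem hnC hch hc
    · refine amalg_not_mem_base S C hC Φ hΦ
        ((true, (((false, g) :: F).map Prod.snd).prod⁻¹) :: (false, g) :: F) (by simp) ?_ ?_ ?_ ?_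
      · intro x hx
        rcases List.mem_cons.1 hx with rfl | hx
        · exact inv_mem h
        · exact hmem x hx
      · intro x hx
        rcases List.mem_cons.1 hx with rfl | hx
        · exact fun h => hc (inv_mem_iff.1 h)
        · exact hnC x hx
      · exact List.IsChain.cons_cons (by simp) hch
      · rw [List.map_cons, List.prod_cons]
        simp
  intro h
  match F, hlen with
  | (false, g) :: F, _ => exact key g F hmem hnC hch h
  | (true, g) :: (true, g') :: F, _ => simp at hch
  | (true, g) :: (false, g') :: F, _ =>
    refine key g' F (fun x hx => hmem x (List.mem_cons_of_mem _ hx))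
      (fun x hx => hnC x (List.mem_cons_of_mem _ hx)) hch.tail ?_
    rw [List.map_cons, List.prod_cons] at h
    exact (Subgroup.mul_mem_cancel_left _ (hmem (true, g) List.mem_cons_self)).1 h

/-- the group -/
abbrev Gr (p : ℕ) := PresentedGroup (gpRels p)

/-- generators -/
def ge (p j : ℕ) : Gr p := PresentedGroup.of j

/-- value of a word -/
def V (p : ℕ) (L : List (ℕ × Bool)) : Gr p := PresentedGroup.mk (gpRels p) (FreeGroup.mk L)

theorem V_nil (p : ℕ) : V p [] = 1 := by
  unfold V; rw [← FreeGroup.one_eq_mk, map_one]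

theorem V_append (p : ℕ) (L M : List (ℕ × Bool)) : V p (L ++ M) = V p L * V p M := by
  unfold V; rw [← FreeGroup.mul_mk, map_mul]

theorem V_true (p j : ℕ) : V p [(j, true)] = ge p j := rfl

theorem V_false (p j : ℕ) : V p [(j, false)] = (ge p j)⁻¹ := by
  unfold V ge PresentedGroup.of
  rw [← map_inv]; rfl

theorem V_cons (p : ℕ) (x : ℕ × Bool) (M : List (ℕ × Bool)) :
    V p (x :: M) = V p [x] * V p M := V_append p [x] M

theorem V_invRev (p : ℕ) (L : List (ℕ × Bool)) : V p (FreeGroup.invRev L) = (V p L)⁻¹ := by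
  unfold V; rw [← FreeGroup.inv_mk, map_inv]

theorem rel (p j : ℕ) : (ge p (j+1))⁻¹ * ge p j * ge p (j+1) * (ge p j ^ p)⁻¹ = 1 := by
  have := PresentedGroup.one_of_mem (rels := gpRels p) ⟨j, rfl⟩
  simp only [map_mul, map_inv, map_pow] at this
  exact this

/-- homs out -/
def hom {p : ℕ} {K : Type*} [Group K] (f : ℕ → K)
    (h : ∀ j, (f (j+1))⁻¹ * f j * f (j+1) * (f j ^ p)⁻¹ = 1) : Gr p →* K :=
  PresentedGroup.toGroup (f := f) (by
    rintro r ⟨j, rfl⟩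
    simpa only [map_mul, map_inv, map_pow, FreeGroup.lift_apply_of] using h j)

theorem hom_ge {p : ℕ} {K : Type*} [Group K] (f : ℕ → K)
    (h : ∀ j, (f (j+1))⁻¹ * f j * f (j+1) * (f j ^ p)⁻¹ = 1) (j : ℕ) :
    hom (p := p) f h (ge p j) = f j := PresentedGroup.toGroup.of _

/-- shift up -/
def up (p : ℕ) : Gr p →* Gr p := hom (fun j => ge p (j+1)) (fun j => rel p (j+1))

/-- shift down -/
def down (p : ℕ) : Gr p →* Gr p := hom (fun j => match j with | 0 => 1 | j+1 => ge p j) (by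
  intro j
  cases j with
  | zero => simp
  | succ j => exact rel p j)

theorem up_ge (p j : ℕ) : up p (ge p j) = ge p (j+1) := hom_ge _ _ _
theorem down_zero (p : ℕ) : down p (ge p 0) = 1 := hom_ge _ _ _
theorem down_succ (p j : ℕ) : down p (ge p (j+1)) = ge p j := hom_ge _ _ _

theorem down_up (p : ℕ) (x : Gr p) : down p (up p x) = x := by
  have : (down p).comp (up p) = MonoidHom.id _ := by
    apply PresentedGroup.ext
    intro j
    change down p (up p (ge p j)) = ge p j
    rw [up_ge, down_succ]
  exact DFunLike.congr_fun this x

/-- word shift up -/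
def wup (L : List (ℕ × Bool)) : List (ℕ × Bool) := L.map (fun x => (x.1 + 1, x.2))

/-- word shift down, deleting letters zero -/
def wdown (L : List (ℕ × Bool)) : List (ℕ × Bool) :=
  L.filterMap (fun x => match x.1 with | 0 => none | j+1 => some (j, x.2))

theorem V_wup (p : ℕ) (L) : V p (wup L) = up p (V p L) := by
  induction L with
  | nil => simp [wup, V_nil]
  | cons x L ih =>
    have : wup (x :: L) = (x.1 + 1, x.2) :: wup L := rfl
    rw [this, V_cons, ih, V_cons p x, map_mul]
    congr 1
    obtain ⟨j, b⟩ := x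
    cases b
    · rw [V_false, V_false, map_inv, up_ge]
    · rw [V_true, V_true, up_ge]

theorem wdown_cons_zero (b : Bool) (L) : wdown ((0, b) :: L) = wdown L := rfl
theorem wdown_cons_succ (j : ℕ) (b : Bool) (L) :
    wdown ((j + 1, b) :: L) = (j, b) :: wdown L := rfl

theorem wdown_append (L M) : wdown (L ++ M) = wdown L ++ wdown M := by
  simp [wdown, List.filterMap_append]

theorem wdown_length (L) : (wdown L).length ≤ L.length := List.length_filterMap_le _ _

theorem wup_length (L) : (wup L).length = L.length := by simp [wup]

theorem V_wdown (p : ℕ) (L) : V p (wdown L) = down p (V p L) := by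
  induction L with
  | nil => simp [wdown, V_nil]
  | cons x L ih =>
    obtain ⟨j, b⟩ := x
    rw [V_cons p (j, b), map_mul, ← ih]
    cases j with
    | zero =>
      rw [wdown_cons_zero]
      cases b
      · rw [V_false, map_inv, down_zero]; simp
      · rw [V_true, down_zero]; simp
    | succ j =>
      rw [wdown_cons_succ, V_cons]
      congr 1
      cases b
      · rw [V_false, V_false, map_inv, down_succ]
      · rw [V_true, V_true, down_succ]

theorem mem_wdown (k : ℕ) (b : Bool) (L : List (ℕ × Bool)) (h : (k+1, b) ∈ L) :
    (k, b) ∈ wdown L := by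
  simp only [wdown, List.mem_filterMap]
  exact ⟨_, h, rfl⟩

theorem wdown_length_lt (L : List (ℕ × Bool)) (b : Bool) (h : (0, b) ∈ L) :
    (wdown L).length + 1 ≤ L.length := by
  obtain ⟨s, t, rfl⟩ := List.append_of_mem h
  rw [wdown_append, wdown_cons_zero]
  have := wdown_length s
  have := wdown_length t
  simp only [List.length_append, List.length_cons]
  omega

/-- all letters positive -/
def Pos (L : List (ℕ × Bool)) : Prop := ∀ x ∈ L, x.1 ≠ 0

theorem wup_wdown (L) (h : Pos L) : wup (wdown L) = L := by
  induction L with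
  | nil => rfl
  | cons x L ih =>
    obtain ⟨j, b⟩ := x
    cases j with
    | zero => exact absurd rfl (h _ List.mem_cons_self)
    | succ j =>
      rw [wdown_cons_succ]
      have := ih (fun x hx => h x (List.mem_cons_of_mem _ hx))
      change (j+1, b) :: wup (wdown L) = _
      rw [this]

theorem Pos.mem_range {p : ℕ} {L} (h : Pos L) : V p L ∈ (up p).range := by
  rw [← wup_wdown L h, V_wup]; exact ⟨_, rfl⟩

theorem range_fix {p : ℕ} {x : Gr p} (h : x ∈ (up p).range) : up p (down p x) = x := by
  obtain ⟨y, rfl⟩ := h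
  rw [down_up]

/-- geodesic words -/
def Geo (p : ℕ) (L : List (ℕ × Bool)) : Prop := ∀ M, V p M = V p L → L.length ≤ M.length

theorem Geo.subword {p : ℕ} {s u t} (h : Geo p (s ++ u ++ t)) : Geo p u := by
  intro M hM
  have := h (s ++ M ++ t) (by simp only [V_append, hM])
  simp only [List.length_append] at this
  omega

theorem Geo.pos {p : ℕ} {L} (h : Geo p L) (hr : V p L ∈ (up p).range) : Pos L := by
  rintro ⟨j, b⟩ hx rfl
  have h1 := h (wup (wdown L)) (by rw [V_wup, V_wdown, range_fix hr])
  rw [wup_length] at h1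
  have := wdown_length_lt L b hx
  omega

theorem Geo.wdown {p : ℕ} {L} (h : Geo p L) (hr : V p L ∈ (up p).range) :
    Geo p (wdown L) := by
  intro M hM
  have h1 := h (wup M) (by rw [V_wup, hM, V_wdown, range_fix hr])
  rw [wup_length] at h1
  exact (wdown_length L).trans h1

/-- the two factors -/
def S (p : ℕ) : Bool → Subgroup (Gr p)
  | true => Subgroup.closure {ge p 0, ge p 1}
  | false => (up p).range

/-- the amalgamated subgroup -/
def C (p : ℕ) : Subgroup (Gr p) := Subgroup.zpowers (ge p 1)

theorem hC (p : ℕ) (b : Bool) : C p ≤ S p b := by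
  unfold C
  rw [Subgroup.zpowers_le]
  cases b
  · exact ⟨ge p 0, up_ge p 0⟩
  · exact Subgroup.subset_closure (by simp)

abbrev Push (p : ℕ) := PushoutI (fun b => Subgroup.inclusion (hC p b))

theorem ge0_mem (p : ℕ) : ge p 0 ∈ S p true := Subgroup.subset_closure (by simp)
theorem ge_mem (p j : ℕ) : ge p (j+1) ∈ S p false := ⟨ge p j, up_ge p j⟩
theorem ge1_mem (p : ℕ) : ge p 1 ∈ S p true := Subgroup.subset_closure (by simp)

/-- images of generators in the amalgam -/
noncomputable def phiGen (p : ℕ) : ℕ → Push p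
  | 0 => PushoutI.of (φ := fun b => Subgroup.inclusion (hC p b)) true ⟨ge p 0, ge0_mem p⟩
  | j+1 => PushoutI.of (φ := fun b => Subgroup.inclusion (hC p b)) false ⟨ge p (j+1), ge_mem p j⟩

theorem phiGen_one (p : ℕ) : phiGen p 1 =
    PushoutI.of (φ := fun b => Subgroup.inclusion (hC p b)) true ⟨ge p 1, ge1_mem p⟩ := by
  have h1 := PushoutI.of_apply_eq_base (fun b => Subgroup.inclusion (hC p b)) true
    ⟨ge p 1, Subgroup.mem_zpowers _⟩
  have h2 := PushoutI.of_apply_eq_base (fun b => Subgroup.inclusion (hC p b)) false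
    ⟨ge p 1, Subgroup.mem_zpowers _⟩
  exact h2.trans h1.symm

noncomputable def phi (p : ℕ) : Gr p →* Push p := hom (phiGen p) (by
  intro j
  cases j with
  | zero =>
    rw [zero_add, phiGen_one]
    simp only [phiGen, ← map_inv, ← map_mul, ← map_pow]
    refine (congrArg _ ?_).trans (map_one (PushoutI.of (φ := fun b => Subgroup.inclusion (hC p b)) _))
    exact Subtype.ext (rel p 0)
  | succ j =>
    simp only [phiGen, ← map_inv, ← map_mul, ← map_pow]
    refine (congrArg _ ?_).trans (map_one (PushoutI.of (φ := fun b => Subgroup.inclusion (hC p b)) _))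
    exact Subtype.ext (rel p (j+1)))

theorem phi_ge (p j : ℕ) : phi p (ge p j) = phiGen p j := hom_ge _ _ _

theorem phi_spec (p : ℕ) (b : Bool) (x : S p b) :
    phi p x = PushoutI.of (φ := fun b => Subgroup.inclusion (hC p b)) b x := by
  cases b with
  | true =>
    obtain ⟨x, hx⟩ := x
    change phi p x = _
    have hx' : x ∈ Subgroup.closure {ge p 0, ge p 1} := hx
    revert hx
    induction hx' using Subgroup.closure_induction with
    | mem x h =>
      intro hx
      rcases h with rfl | h
      · rw [phi_ge]; rfl
      · obtain rfl : x = ge p 1 := h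
        rw [phi_ge, phiGen_one]
    | one => intro _; rw [map_one]; exact (map_one _).symm
    | mul x y hx hy ihx ihy =>
      intro _
      rw [map_mul, ihx hx, ihy hy, ← map_mul]; rfl
    | inv x hx ih =>
      intro _
      rw [map_inv, ih hx, ← map_inv]; rfl
  | false =>
    obtain ⟨x, y, rfl⟩ := x
    have : (phi p).comp (up p) = (PushoutI.of (φ := fun b => Subgroup.inclusion (hC p b))
      false).comp (up p).rangeRestrict := by
      apply PresentedGroup.ext
      intro j
      change phi p (up p (ge p j)) = PushoutI.of (φ := fun b => Subgroup.inclusion (hC p b)) false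
        ⟨up p (ge p j), _⟩
      simp only [up_ge, phi_ge]
      rfl
    exact DFunLike.congr_fun this y

/-- good words -/
def Good (p : ℕ) (L : List (ℕ × Bool)) : Prop :=
  V p L ∈ S p true ∧ ∀ x ∈ L, x.1 ≠ 0 →
    ∃ s u t, L = s ++ u ++ t ∧ x ∈ u ∧ Pos u ∧ V p u ∈ C p

theorem Good.append {p : ℕ} {L M} (hL : Good p L) (hM : Good p M) : Good p (L ++ M) := by
  refine ⟨by rw [V_append]; exact mul_mem hL.1 hM.1, ?_⟩
  intro x hx hx0
  rcases List.mem_append.1 hx with hx | hx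
  · obtain ⟨s, u, t, rfl, h⟩ := hL.2 x hx hx0
    exact ⟨s, u, t ++ M, by simp, h⟩
  · obtain ⟨s, u, t, rfl, h⟩ := hM.2 x hx hx0
    exact ⟨L ++ s, u, t, by simp, h⟩

/-- valid piece -/
def Valid (p : ℕ) : Bool → List (ℕ × Bool) → Prop
  | true, L => Good p L
  | false, L => Pos L

theorem Valid.append {p : ℕ} {b L M} (hL : Valid p b L) (hM : Valid p b M) :
    Valid p b (L ++ M) := by
  cases b with
  | true => exact Good.append hL hM
  | false =>
    intro x hx
    rcases List.mem_append.1 hx with hx | hx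
    · exact hL x hx
    · exact hM x hx

theorem Valid.mem {p : ℕ} {b L} (h : Valid p b L) : V p L ∈ S p b := by
  cases b with
  | true => exact h.1
  | false => exact Pos.mem_range h

theorem Valid.change {p : ℕ} {b L} (h : Valid p b L) (hg : Geo p L) (hc : V p L ∈ C p)
    (b' : Bool) : Valid p b' L := by
  have hp : Pos L := hg.pos (hC p false hc)
  cases b' with
  | false => exact hp
  | true => exact ⟨hC p true hc, fun x hx _ => ⟨[], L, [], by simp, hx, hp, hc⟩⟩

/-- factorizations -/
def Fact (p : ℕ) (L : List (ℕ × Bool)) (F : List (Bool × List (ℕ × Bool))) : Prop :=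
  (∀ x ∈ F, Valid p x.1 x.2) ∧ (F.map Prod.snd).flatten = L

theorem exists_fact (p : ℕ) (L) : ∃ F, Fact p L F := by
  induction L with
  | nil => exact ⟨[], by simp [Fact]⟩
  | cons x L ih =>
    obtain ⟨F, hF, rfl⟩ := ih
    obtain ⟨j, b⟩ := x
    by_cases hj : j = 0
    · subst hj
      refine ⟨(true, [(0, b)]) :: F, ?_, by simp⟩
      intro y hy
      rcases List.mem_cons.1 hy with rfl | hy
      · refine ⟨?_, ?_⟩
        · cases b
          · rw [V_false]; exact inv_mem (ge0_mem p)
          · rw [V_true]; exact ge0_mem p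
        · intro x hx hx0
          rw [List.mem_singleton] at hx
          subst hx
          exact absurd rfl hx0
      · exact hF y hy
    · refine ⟨(false, [(j, b)]) :: F, ?_, by simp⟩
      intro y hy
      rcases List.mem_cons.1 hy with rfl | hy
      · intro x hx
        rw [List.mem_singleton] at hx
        subst hx
        exact hj
      · exact hF y hy

theorem Fact.merge {p : ℕ} {L A x y B} (h : Fact p L (A ++ x :: y :: B)) (b : Bool)
    (hx : Valid p b x.2) (hy : Valid p b y.2) : Fact p L (A ++ (b, x.2 ++ y.2) :: B) := by
  obtain ⟨h1, h2⟩ := h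
  refine ⟨?_, ?_⟩
  · intro z hz
    rcases List.mem_append.1 hz with hz | hz
    · exact h1 z (by simp [hz])
    · rcases List.mem_cons.1 hz with rfl | hz
      · exact hx.append hy
      · exact h1 z (by simp [hz])
  · rw [← h2]; simp

theorem V_flatten (p : ℕ) (Ls : List (List (ℕ × Bool))) :
    V p Ls.flatten = (Ls.map (V p)).prod := by
  induction Ls with
  | nil => simp [V_nil]
  | cons a Ls ih => simp [V_append, ih]

theorem good_of_geo {p : ℕ} {L} (hg : Geo p L) (n : ℤ) (hV : V p L = ge p 0 ^ n) :
    Good p L := by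
  classical
  have hex : ∃ m F, Fact p L F ∧ F.length = m := by
    obtain ⟨F, hF⟩ := exists_fact p L
    exact ⟨_, F, hF, rfl⟩
  obtain ⟨F, hF, hlen⟩ := Nat.find_spec hex
  have hmin : ∀ F', Fact p L F' → F.length ≤ F'.length := by
    intro F' hF'
    rw [hlen]
    exact Nat.find_min' hex ⟨F', hF', rfl⟩
  have hnil : V p L ∈ (up p).range → L = [] := by
    intro h
    have h2 := range_fix h
    rw [hV, map_zpow, down_zero] at h2
    have h3 : V p L = V p [] := by rw [V_nil, hV, ← h2]; simp
    have := hg [] h3.symm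
    exact List.length_eq_zero_iff.1 (by simpa using this)
  have hgoodnil : Good p [] := ⟨by rw [V_nil]; exact one_mem _, by simp⟩
  by_cases h2 : 2 ≤ F.length
  · exfalso
    have hnomerge : ∀ A x y B, F = A ++ x :: y :: B → ∀ b,
        Valid p b x.2 → Valid p b y.2 → False := by
      rintro A x y B rfl b hx hy
      have := hmin _ (hF.merge b hx hy)
      simp at this
    have hgeo : ∀ A x B, F = A ++ x :: B → Geo p x.2 := by
      rintro A x B rfl
      have := hF.2
      apply Geo.subword (s := (A.map Prod.snd).flatten) (t := (B.map Prod.snd).flatten)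
      rw [← this] at hg
      simpa using hg
    have hnC : ∀ x ∈ F, V p x.2 ∉ C p := by
      intro x hx hc
      obtain ⟨A, B, hAB⟩ := List.append_of_mem hx
      have hch := (hF.1 x hx).change (hgeo A x B hAB) hc
      cases B with
      | cons y B =>
        exact hnomerge A x y B hAB y.1 (hch _) (hF.1 y (by simp [hAB]))
      | nil =>
        rcases List.eq_nil_or_concat A with rfl | ⟨A', y, rfl⟩
        · simp [hAB] at h2
        · exact hnomerge A' y x [] (by simp [hAB]) y.1 (hF.1 y (by simp [hAB])) (hch _)
    have hchain : F.IsChain (fun x y => x.1 ≠ y.1) := by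
      rw [List.isChain_iff_forall_rel_of_append_cons_cons]
      intro x y A B hAB hxy
      refine hnomerge A x y B hAB x.1 (hF.1 x (by simp [hAB])) ?_
      rw [hxy]
      exact hF.1 y (by simp [hAB])
    refine amalg_not_mem (S p) (C p) (hC p) (phi p) (phi_spec p)
      (F.map (fun x => (x.1, V p x.2))) (by simpa using h2) ?_ ?_ ?_ ?_
    · intro x hx
      obtain ⟨y, hy, rfl⟩ := List.mem_map.1 hx
      exact (hF.1 y hy).mem
    · intro x hx
      obtain ⟨y, hy, rfl⟩ := List.mem_map.1 hx
      exact hnC y hy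
    · rw [List.isChain_map]; exact hchain
    · have : ((F.map (fun x => (x.1, V p x.2))).map Prod.snd).prod = V p L := by
        rw [← hF.2, V_flatten]
        simp [Function.comp_def]
      rw [this, hV]
      exact zpow_mem (ge0_mem p) n
  · match F, h2, hF with
    | [], _, hF =>
      have := hF.2
      simp at this
      rw [this]; exact hgoodnil
    | [(true, M)], _, hF =>
      have h3 := hF.2
      simp at h3
      rw [← h3]
      exact hF.1 (true, M) (by simp)
    | [(false, M)], _, hF =>
      have h3 := hF.2
      simp at h3
      have h4 : Pos M := hF.1 (false, M) (by simp)
      rw [h3] at h4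
      rw [hnil h4.mem_range]
      exact hgoodnil
    | _ :: _ :: _, h2, _ => simp at h2

theorem main_zero (p i : ℕ) : ∀ (L : List (ℕ × Bool)) (b : Bool) (n : ℤ), Geo p L →
    (i, b) ∈ L → V p L = ge p 0 ^ n → 2 ^ (i + 1) - 1 ≤ L.length := by
  induction i with
  | zero =>
    intro L b n _ hb _
    have := List.length_pos_of_mem hb
    simp only [zero_add, pow_one]
    omega
  | succ i ih =>
    intro L b n hg hb hV
    obtain ⟨s, u, t, rfl, hu, hpos, hc⟩ := (good_of_geo hg n hV).2 _ hb (by simp)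
    have hgu : Geo p u := hg.subword
    have hur := hpos.mem_range (p := p)
    obtain ⟨m, hm⟩ := hc
    have h1 := ih (wdown u) b m (hgu.wdown hur) (mem_wdown _ _ _ hu) (by
      rw [V_wdown, ← hm]
      change down p (ge p 1 ^ m) = _
      rw [map_zpow, down_succ])
    have h1' := wdown_length u
    have hprod : V p (wdown s) * V p (wdown u) * V p (wdown t) = 1 := by
      rw [← V_append, ← V_append, ← wdown_append, ← wdown_append, V_wdown, hV, map_zpow,
        down_zero, one_zpow]
    have h2 := (hgu.wdown hur) (FreeGroup.invRev (wdown t ++ wdown s)) (by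
      rw [V_invRev, V_append, mul_inv_rev, inv_mul_eq_iff_eq_mul]
      exact (eq_inv_of_mul_eq_one_left hprod).symm)
    rw [FreeGroup.invRev_length, List.length_append] at h2
    have hzero : ∃ b, (0, b) ∈ s ++ u ++ t := by
      by_contra hno
      push Not at hno
      have hpL : Pos (s ++ u ++ t) := by
        rintro ⟨j, b⟩ hx rfl
        exact hno b hx
      have h3 := range_fix (hpL.mem_range (p := p))
      rw [hV, map_zpow, down_zero, one_zpow, map_one] at h3
      have h4 := hg [] (by rw [V_nil, hV, h3])
      have := List.length_pos_of_mem hb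
      simp only [List.length_nil] at h4
      omega
    obtain ⟨b', hb'⟩ := hzero
    have h5 := wdown_length_lt _ _ hb'
    rw [wdown_append, wdown_append, List.length_append, List.length_append] at h5
    have : 2 ^ (i + 1 + 1) = 2 * 2 ^ (i + 1) := by ring
    omega

theorem main_gen (p j : ℕ) : ∀ (i : ℕ) (L : List (ℕ × Bool)) (b : Bool) (n : ℤ), Geo p L →
    (i + j, b) ∈ L → V p L = ge p j ^ n → 2 ^ (i + 1) - 1 ≤ L.length := by
  induction j with
  | zero => intro i L b n; exact main_zero p i L b n
  | succ j ih =>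
    intro i L b n hg hb hV
    have hr : V p L ∈ (up p).range := by
      rw [hV]; exact zpow_mem (ge_mem p j) n
    refine (ih i (wdown L) b n (hg.wdown hr) (mem_wdown _ _ _ hb) ?_).trans (wdown_length L)
    rw [V_wdown, hV, map_zpow, down_succ]

theorem geo_of (p : ℕ) (L : List (ℕ × Bool))
    (hgeo : L.length = wordLength
      (Set.range fun j : ℕ => (PresentedGroup.of (rels := gpRels p) j))
      (PresentedGroup.mk (gpRels p) (FreeGroup.mk L))) : Geo p L := by
  intro M hM
  rw [hgeo]
  apply Nat.sInf_le
  refine ⟨M.map (fun x => V p [x]), by simp, ?_, ?_⟩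
  · intro x hx
    obtain ⟨⟨j, b⟩, -, rfl⟩ := List.mem_map.1 hx
    cases b
    · right; rw [V_false, inv_inv]; exact ⟨j, rfl⟩
    · left; exact ⟨j, rfl⟩
  · change _ = V p L
    rw [← hM]
    clear hM
    induction M with
    | nil => simp [V_nil]
    | cons x M ih => rw [List.map_cons, List.prod_cons, ih, ← V_cons]

end GP

/-- Any geodesic word in `G'` containing the letter `a_k^{±1}` and representing an element of
the cyclic subgroup `⟨a_{k-i}⟩` has length at least `2^{i+1} - 1`. -/
theorem geodesic_containing_ak_long (p : ℕ) (hp : 2 ≤ p) (i k : ℕ) (hik : i ≤ k)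
    (L : List (ℕ × Bool))
    (hgeo : L.length = wordLength
      (Set.range fun j : ℕ => (PresentedGroup.of (rels := gpRels p) j))
      (PresentedGroup.mk (gpRels p) (FreeGroup.mk L)))
    (hcontains : ∃ b : Bool, (k, b) ∈ L)
    (n : ℤ) (hrep : PresentedGroup.mk (gpRels p) (FreeGroup.mk L)
      = (PresentedGroup.of (rels := gpRels p) (k - i)) ^ n) :
    2 ^ (i + 1) - 1 ≤ L.length := by
  obtain ⟨b, hb⟩ := hcontains
  refine GP.main_gen p (k - i) i L b n (GP.geo_of p L hgeo) ?_ hrep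
  rwa [Nat.add_sub_cancel' hik]
end
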